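/- Let L > 0, let p denote the Neumann heat kernel on [0,L], define the operator (𝒫ψ)(t,x) := ∫₀ᵗ ∫₀ᴸ [p_{t−s}(x,y)]² ψ(s,y) dy ds acting on nonnegative Borel functions ψ : (0,∞) × [0,L] → ℝ₊, let 𝟏(t,x) := 1, and let Φ(τ) := ∫₀^τ ∫₀ᴸ ∫₀ᴸ [p_s(x,y)]² dx dy ds. Then for every integer k ≥ 1 and every t > 0, ∫₀ᴸ (𝒫ᵏ𝟏)(t,x) dx ≥ L · (Φ(t/k)/L)ᵏ, where 𝒫ᵏ denotes the k-fold iterate of 𝒫. -/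

import Mathlib

open MeasureTheory Real

/-- The Gaussian heat kernel on `ℝ`: `Γ_t(z) = (4πt)^{-1/2} exp(-z²/(4t))`. -/
noncomputable def heatGauss (t z : ℝ) : ℝ :=
  Real.exp (-z ^ 2 / (4 * t)) / Real.sqrt (4 * π * t)

/-- The Neumann heat kernel on `[0, L]`, obtained by the method of images:
`p_t(x,y) = ∑_{n ∈ ℤ} [Γ_t(x-y-2nL) + Γ_t(x+y-2nL)]`. -/
noncomputable def neumannHeatKernel (L t x y : ℝ) : ℝ :=
  ∑' n : ℤ, (heatGauss t (x - y - 2 * (n : ℝ) * L) + heatGauss t (x + y - 2 * (n : ℝ) * L))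

/-- The operator `(𝒫ψ)(t,x) = ∫₀ᵗ ∫₀ᴸ [p_{t-s}(x,y)]² ψ(s,y) dy ds`. -/
noncomputable def heatSqOp (L : ℝ) (ψ : ℝ → ℝ → ℝ) : ℝ → ℝ → ℝ :=
  fun t x =>
    ∫ s in (0 : ℝ)..t, ∫ y in (0 : ℝ)..L, (neumannHeatKernel L (t - s) x y) ^ 2 * ψ s y

/-- `Φ(τ) = ∫₀^τ ∫₀ᴸ ∫₀ᴸ [p_s(x,y)]² dx dy ds`. -/
noncomputable def neumannPhi (L τ : ℝ) : ℝ :=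
  ∫ s in (0 : ℝ)..τ, ∫ y in (0 : ℝ)..L, ∫ x in (0 : ℝ)..L, (neumannHeatKernel L s x y) ^ 2

open Function

theorem abs_log_le_of_mem_Icc {m M u : ℝ} (hm : 0 < m) (hu : u ∈ Set.Icc m M) :
    |log u| ≤ |log m| + |log M| := by
  have h1 := Real.log_le_log hm hu.1
  have h2 := Real.log_le_log (hm.trans_le hu.1) hu.2
  rw [abs_le]
  constructor
  · linarith [neg_abs_le (log m), abs_nonneg (log M)]
  · linarith [le_abs_self (log M), abs_nonneg (log m)]

section SymmetricKernel

variable {X : Type*} [MeasurableSpace X] {μ : Measure X} {q : X → X → ℝ} {m M : ℝ}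

theorem ae_integrable_of_degree_pos (hm : 0 < m)
    (hd : ∀ᵐ x ∂μ, m ≤ ∫ y, q x y ∂μ ∧ ∫ y, q x y ∂μ ≤ M) :
    ∀ᵐ x ∂μ, Integrable (q x) μ := by
  filter_upwards [hd] with x hx
  by_contra h
  rw [integral_undef h] at hx
  linarith [hx.1]

theorem integrable_uncurry_of_degree_bounds [IsFiniteMeasure μ]
    (hq0 : ∀ x y, 0 ≤ q x y) (hqm : Measurable (uncurry q)) (hm : 0 < m)
    (hd : ∀ᵐ x ∂μ, m ≤ ∫ y, q x y ∂μ ∧ ∫ y, q x y ∂μ ≤ M) :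
    Integrable (uncurry q) (μ.prod μ) := by
  rw [integrable_prod_iff hqm.aestronglyMeasurable]
  refine ⟨ae_integrable_of_degree_pos hm hd, ?_⟩
  have hmeas : StronglyMeasurable fun x => ∫ y, q x y ∂μ :=
    StronglyMeasurable.integral_prod_right hqm.stronglyMeasurable
  simp only [uncurry, Real.norm_of_nonneg (hq0 _ _)]
  refine Integrable.of_bound hmeas.aestronglyMeasurable M ?_
  filter_upwards [hd] with x hx
  rw [Real.norm_of_nonneg (by linarith)]
  exact hx.2

/-- Integrating a symmetric kernel against a bounded function amounts to integrating the
function against the degree of the kernel. -/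
theorem integral_integral_mul_eq_integral_degree_mul [IsFiniteMeasure μ]
    (hsymm : ∀ x y, q x y = q y x) (hinteg : Integrable (uncurry q) (μ.prod μ))
    {h : X → ℝ} (hh : Measurable h) {B : ℝ}
    (hB : ∀ᵐ x ∂μ, |h x| ≤ B) :
    ∫ x, ∫ y, q x y * h y ∂μ ∂μ = ∫ x, (∫ y, q x y ∂μ) * h x ∂μ := by
  have hprod : Integrable (uncurry fun x y => q x y * h y) (μ.prod μ) :=
    Integrable.mul_bdd (f := uncurry q) (g := fun z => h z.2) (c := B) hinteg
      (hh.comp measurable_snd).aestronglyMeasurable (Measure.quasiMeasurePreserving_snd.ae hB)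
  rw [integral_integral_swap hprod]
  refine integral_congr_ae (.of_forall fun y => ?_)
  simp only [integral_mul_const, hsymm _ y]

/-- Jensen's inequality for the exponential with respect to an unnormalised density. -/
theorem integral_mul_exp_ge {w g : X → ℝ} (hw0 : ∀ y, 0 ≤ w y) (hw : 0 < ∫ y, w y ∂μ)
    (hwg : Integrable (fun y => w y * g y) μ)
    (hwe : Integrable (fun y => w y * exp (g y)) μ) :
    (∫ y, w y ∂μ) * exp ((∫ y, w y * g y ∂μ) / ∫ y, w y ∂μ) ≤ ∫ y, w y * exp (g y) ∂μ := by
  have hwi : Integrable w μ := by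
    by_contra h
    rw [integral_undef h] at hw
    exact lt_irrefl _ hw
  set d := ∫ y, w y ∂μ
  set a := (∫ y, w y * g y ∂μ) / d with ha
  have htangent : ∀ y, exp a * (w y * g y + (1 - a) * w y) ≤ w y * exp (g y) := fun y => by
    have h1 := Real.add_one_le_exp (g y - a)
    have h2 : exp (g y) = exp a * exp (g y - a) := by rw [← Real.exp_add]; ring_nf
    rw [h2]
    nlinarith [mul_le_mul_of_nonneg_left h1 (mul_nonneg (exp_pos a).le (hw0 y))]
  calc d * exp a = ∫ y, exp a * (w y * g y + (1 - a) * w y) ∂μ := by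
        rw [integral_const_mul, integral_add hwg (hwi.const_mul _), integral_const_mul]
        have : ∫ y, w y * g y ∂μ = a * d := by rw [ha]; field_simp
        rw [this]; ring
    _ ≤ _ := integral_mono ((hwg.add (hwi.const_mul _)).const_mul _) hwe htangent

/-- The iterates of a kernel applied to `1` dominate `d * exp h`, where `d` is the degree of the
kernel and `h` is a bounded function whose mean against `d` is known. -/
theorem exists_degree_mul_exp_le_iterate [IsFiniteMeasure μ]
    (hq0 : ∀ x y, 0 ≤ q x y) (hqm : Measurable (uncurry q)) (hsymm : ∀ x y, q x y = q y x)
    (hm : 0 < m)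
    (hd : ∀ᵐ x ∂μ, m ≤ ∫ y, q x y ∂μ ∧ ∫ y, q x y ∂μ ≤ M) (j : ℕ) :
    ∃ (h : X → ℝ) (B : ℝ), Measurable h ∧ (∀ᵐ x ∂μ, |h x| ≤ B) ∧
      ∫ x, (∫ y, q x y ∂μ) * h x ∂μ = j * ∫ x, (∫ y, q x y ∂μ) * log (∫ y, q x y ∂μ) ∂μ ∧
      ∀ᵐ x ∂μ, ENNReal.ofReal ((∫ y, q x y ∂μ) * exp (h x)) ≤
        (fun (f : X → ENNReal) x => ∫⁻ y, ENNReal.ofReal (q x y) * f y ∂μ)^[j + 1] 1 x := by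
  have hqi := ae_integrable_of_degree_pos hm hd
  have hinteg := integrable_uncurry_of_degree_bounds hq0 hqm hm hd
  have hdm : Measurable fun x => ∫ y, q x y ∂μ :=
    (StronglyMeasurable.integral_prod_right hqm.stronglyMeasurable).measurable
  induction j with
  | zero =>
    refine ⟨fun _ => 0, 0, measurable_const, by simp, by simp, ?_⟩
    filter_upwards [hqi] with x hx
    simp only [exp_zero, mul_one, zero_add, iterate_one, Pi.one_apply]
    rw [ofReal_integral_eq_lintegral_ofReal hx (.of_forall (hq0 x))]
  | succ j ih =>
    obtain ⟨h, B, hhm, hB, hmean, hle⟩ := ih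
    set d : X → ℝ := fun x => ∫ y, q x y ∂μ
    set g : X → ℝ := fun y => log (d y) + h y with hg_def
    have hgm : Measurable g := hdm.log.add hhm
    set C : ℝ := |log m| + |log M|
    have hlogB : ∀ᵐ x ∂μ, |log (d x)| ≤ C :=
      hd.mono fun x hx => abs_log_le_of_mem_Icc hm hx
    have hgB : ∀ᵐ x ∂μ, |g x| ≤ C + B := by
      filter_upwards [hlogB, hB] with x h1 h2
      exact (abs_add_le _ _).trans (add_le_add h1 h2)
    have hqg : ∀ᵐ x ∂μ, Integrable (fun y => q x y * g y) μ := by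
      filter_upwards [hqi] with x hx
      exact hx.mul_bdd hgm.aestronglyMeasurable hgB
    have hqe : ∀ᵐ x ∂μ, Integrable (fun y => q x y * exp (g y)) μ := by
      filter_upwards [hqi] with x hx
      refine hx.mul_bdd (c := exp (C + B)) hgm.exp.aestronglyMeasurable ?_
      filter_upwards [hgB] with y hy
      rw [Real.norm_of_nonneg (exp_pos _).le]
      exact exp_le_exp.2 ((le_abs_self _).trans hy)
    have hdi : Integrable d μ := hinteg.integral_prod_left
    refine ⟨fun x => (∫ y, q x y * g y ∂μ) / d x, C + B, ?_, ?_, ?_, ?_⟩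
    · refine Measurable.div (StronglyMeasurable.measurable ?_) hdm
      exact StronglyMeasurable.integral_prod_right
        (hqm.mul (hgm.comp measurable_snd)).stronglyMeasurable
    · filter_upwards [hd, hqi] with x hx hxi
      have hpos : 0 < d x := hm.trans_le hx.1
      rw [abs_div, abs_of_pos hpos, div_le_iff₀ hpos]
      calc |∫ y, q x y * g y ∂μ| ≤ ∫ y, q x y * (C + B) ∂μ := by
            refine norm_integral_le_of_norm_le (f := fun y => q x y * g y) (hxi.mul_const _) ?_
            filter_upwards [hgB] with y hy
            rw [norm_mul, Real.norm_of_nonneg (hq0 x y)]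
            exact mul_le_mul_of_nonneg_left hy (hq0 x y)
        _ = (C + B) * d x := by rw [integral_mul_const, mul_comm]
    · have hcancel : ∫ x, d x * ((∫ y, q x y * g y ∂μ) / d x) ∂μ
          = ∫ x, ∫ y, q x y * g y ∂μ ∂μ := by
        refine integral_congr_ae ?_
        filter_upwards [hd] with x hx
        have hpos : 0 < d x := hm.trans_le hx.1
        field_simp
      rw [hcancel, integral_integral_mul_eq_integral_degree_mul hsymm hinteg hgm hgB]
      simp only [hg_def, mul_add]
      rw [integral_add, hmean]
      · push_cast; ring
      · exact hdi.mul_bdd hdm.log.aestronglyMeasurable hlogB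
      · exact hdi.mul_bdd hhm.aestronglyMeasurable hB
    · filter_upwards [hd, hqg, hqe] with x hx hxg hxe
      have hpos : 0 < d x := hm.trans_le hx.1
      rw [iterate_succ_apply']
      refine (ENNReal.ofReal_le_ofReal (integral_mul_exp_ge (hq0 x) hpos hxg hxe)).trans ?_
      rw [ofReal_integral_eq_lintegral_ofReal hxe
        (.of_forall fun y => mul_nonneg (hq0 x y) (exp_pos _).le)]
      refine lintegral_mono_ae ?_
      filter_upwards [hle, hd] with y hy hdy
      rw [ENNReal.ofReal_mul (hq0 x y)]
      refine mul_le_mul_right (le_trans (le_of_eq ?_) hy) _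
      rw [exp_add, exp_log (hm.trans_le hdy.1)]

/-- The Blakley–Roy inequality: for a symmetric nonnegative kernel whose degree is bounded and
bounded away from zero, the total mass of the `(j+1)`-st iterate on `1` is at least that of the
constant kernel with the same mass. -/
theorem lintegral_iterate_ge_of_symmetric [IsFiniteMeasure μ]
    (hq0 : ∀ x y, 0 ≤ q x y) (hqm : Measurable (uncurry q)) (hsymm : ∀ x y, q x y = q y x)
    (hm : 0 < m)
    (hd : ∀ᵐ x ∂μ, m ≤ ∫ y, q x y ∂μ ∧ ∫ y, q x y ∂μ ≤ M)
    (hμ : 0 < μ.real Set.univ) (j : ℕ) :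
    ENNReal.ofReal (μ.real Set.univ * ((∫ x, ∫ y, q x y ∂μ ∂μ) / μ.real Set.univ) ^ (j + 1)) ≤
      ∫⁻ x, (fun (f : X → ENNReal) x => ∫⁻ y, ENNReal.ofReal (q x y) * f y ∂μ)^[j + 1] 1 x ∂μ := by
  have hinteg := integrable_uncurry_of_degree_bounds hq0 hqm hm hd
  obtain ⟨h, B, hhm, hB, hmean, hle⟩ :=
    exists_degree_mul_exp_le_iterate hq0 hqm hsymm hm hd j
  have hdm : Measurable fun x => ∫ y, q x y ∂μ :=
    (StronglyMeasurable.integral_prod_right hqm.stronglyMeasurable).measurable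
  have hdi : Integrable (fun x => ∫ y, q x y ∂μ) μ := hinteg.integral_prod_left
  set d : X → ℝ := fun x => ∫ y, q x y ∂μ
  set V := μ.real Set.univ with hV
  set D := ∫ x, d x ∂μ
  have hDpos : 0 < D := by
    have : ∫ _, m ∂μ ≤ D :=
      integral_mono_ae (integrable_const m) hdi (hd.mono fun x hx => hx.1)
    rw [integral_const, smul_eq_mul] at this
    exact (mul_pos hμ hm).trans_le this
  set c := D / V with hc
  have hcpos : 0 < c := div_pos hDpos hμ
  have hdh : Integrable (fun x => d x * h x) μ := hdi.mul_bdd hhm.aestronglyMeasurable hB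
  have hde : Integrable (fun x => d x * exp (h x)) μ := by
    refine hdi.mul_bdd (c := exp B) hhm.exp.aestronglyMeasurable ?_
    filter_upwards [hB] with y hy
    rw [Real.norm_of_nonneg (exp_pos _).le]
    exact exp_le_exp.2 ((le_abs_self _).trans hy)
  have hdlog : Integrable (fun x => d x * log (d x)) μ :=
    hdi.mul_bdd hdm.log.aestronglyMeasurable (hd.mono fun x hx => abs_log_le_of_mem_Icc hm hx)
  have hentropy : D * log c ≤ ∫ x, d x * log (d x) ∂μ := by
    have hpt : ∀ᵐ x ∂μ, d x * log c + (d x - c) ≤ d x * log (d x) := by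
      filter_upwards [hd] with x hx
      have hpos : 0 < d x := hm.trans_le hx.1
      have h1 := Real.log_le_sub_one_of_pos (div_pos hcpos hpos)
      rw [Real.log_div hcpos.ne' hpos.ne'] at h1
      have h2 := mul_le_mul_of_nonneg_left h1 hpos.le
      have h3 : d x * (c / d x - 1) = c - d x := by field_simp
      rw [h3] at h2
      linarith
    have hsub : Integrable (fun x => d x - c) μ := hdi.sub (integrable_const c)
    have hmono := integral_mono_ae ((hdi.mul_const _).add hsub) hdlog hpt
    have hzero : ∫ x, (d x * log c + (d x - c)) ∂μ = D * log c := by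
      rw [integral_add (hdi.mul_const _) hsub, integral_mul_const,
        integral_sub hdi (integrable_const c), integral_const, smul_eq_mul, ← hV, hc]
      field_simp
      ring
    exact hzero ▸ hmono
  have hreal : V * c ^ (j + 1) ≤ ∫ x, d x * exp (h x) ∂μ := by
    have hpt : ∀ᵐ x ∂μ,
        c ^ j * (d x * h x + (1 - j * log c) * d x) ≤ d x * exp (h x) := by
      filter_upwards [hd] with x hx
      have hpos : 0 < d x := hm.trans_le hx.1
      have h1 := Real.add_one_le_exp (h x - j * log c)
      have h2 : exp (h x) = c ^ j * exp (h x - j * log c) := by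
        rw [Real.exp_sub, Real.exp_nat_mul, Real.exp_log hcpos]
        field_simp
      rw [h2]
      nlinarith [mul_le_mul_of_nonneg_left h1 (mul_nonneg (pow_pos hcpos j).le hpos.le)]
    have hmono := integral_mono_ae ((hdh.add (hdi.const_mul _)).const_mul _) hde hpt
    refine le_trans ?_ hmono
    simp only [Pi.add_apply]
    rw [integral_const_mul, integral_add hdh (hdi.const_mul _), integral_const_mul, hmean]
    have hVc : V * c ^ (j + 1) = c ^ j * D := by
      rw [pow_succ, hc]; field_simp
    rw [hVc]
    refine mul_le_mul_of_nonneg_left ?_ (pow_pos hcpos j).le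
    have := mul_le_mul_of_nonneg_left hentropy (Nat.cast_nonneg (α := ℝ) j)
    linarith
  refine (ENNReal.ofReal_le_ofReal hreal).trans ?_
  rw [ofReal_integral_eq_lintegral_ofReal hde
    (hd.mono fun x hx => mul_nonneg (hm.le.trans hx.1) (exp_pos _).le)]
  exact lintegral_mono_ae hle

end SymmetricKernel

section VolterraOperator

variable {X : Type*} [MeasurableSpace X]

/-- The operator `f ↦ ∫₀ᵗ ∫ κ_{t-s}(x,y) f(s,y) dμ(y) ds` on extended nonnegative functions. -/
noncomputable def volterraOp (κ : ℝ → X → X → ENNReal) (μ : Measure X) (f : ℝ → X → ENNReal) :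
    ℝ → X → ENNReal :=
  fun t x => ∫⁻ s in Set.Ioc 0 t, ∫⁻ y, κ (t - s) x y * f s y ∂μ

/-- The space operator whose kernel is `∫₀^τ κ_r dr`. -/
noncomputable def timeIntegratedOp (κ : ℝ → X → X → ENNReal) (μ : Measure X) (τ : ℝ)
    (f : X → ENNReal) : X → ENNReal :=
  fun x => ∫⁻ y, (∫⁻ r in Set.Ioc 0 τ, κ r x y) * f y ∂μ

variable {κ : ℝ → X → X → ENNReal} {μ : Measure X}

theorem measurable_volterraOp [SFinite μ]
    (hκ : Measurable fun z : ℝ × X × X => κ z.1 z.2.1 z.2.2)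
    {f : ℝ → X → ENNReal} (hf : Measurable (uncurry f)) :
    Measurable (uncurry (volterraOp κ μ f)) := by
  have hinner : Measurable fun z : (ℝ × X) × ℝ =>
      ∫⁻ y, κ (z.1.1 - z.2) z.1.2 y * f z.2 y ∂μ := by
    refine Measurable.lintegral_prod_right'
      (f := fun w : ((ℝ × X) × ℝ) × X => κ (w.1.1.1 - w.1.2) w.1.1.2 w.2 * f w.1.2 w.2) ?_
    refine Measurable.mul ?_ ?_
    · exact hκ.comp (by fun_prop :
        Measurable fun w : ((ℝ × X) × ℝ) × X => (w.1.1.1 - w.1.2, w.1.1.2, w.2))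
    · exact hf.comp (by fun_prop : Measurable fun w : ((ℝ × X) × ℝ) × X => (w.1.2, w.2))
  have hset : MeasurableSet {z : (ℝ × X) × ℝ | z.2 ∈ Set.Ioc 0 z.1.1} :=
    (measurableSet_lt measurable_const measurable_snd).inter
      (measurableSet_le measurable_snd (measurable_fst.comp measurable_fst))
  have hind := (hinner.indicator hset).lintegral_prod_right' (ν := (volume : Measure ℝ))
  convert hind using 2 with z
  rw [uncurry, volterraOp, ← lintegral_indicator measurableSet_Ioc]
  rfl

theorem measurable_iterate_volterraOp [SFinite μ]
    (hκ : Measurable fun z : ℝ × X × X => κ z.1 z.2.1 z.2.2) (j : ℕ) :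
    Measurable (uncurry ((volterraOp κ μ)^[j] 1)) := by
  induction j with
  | zero => exact measurable_const
  | succ j ih =>
    rw [iterate_succ_apply']
    exact measurable_volterraOp hκ ih

theorem measurable_lintegral_Ioc_kernel
    (hκ : Measurable fun z : ℝ × X × X => κ z.1 z.2.1 z.2.2) (τ : ℝ) :
    Measurable (uncurry fun x y => ∫⁻ r in Set.Ioc 0 τ, κ r x y) :=
  Measurable.lintegral_prod_right' (f := fun w : (X × X) × ℝ => κ w.2 w.1.1 w.1.2)
    (hκ.comp (by fun_prop : Measurable fun w : (X × X) × ℝ => (w.2, w.1.1, w.1.2)))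

theorem measurable_iterate_timeIntegratedOp [SFinite μ]
    (hκ : Measurable fun z : ℝ × X × X => κ z.1 z.2.1 z.2.2) (τ : ℝ) (j : ℕ) :
    Measurable ((timeIntegratedOp κ μ τ)^[j] 1) := by
  induction j with
  | zero => exact measurable_const
  | succ j ih =>
    rw [iterate_succ_apply']
    exact Measurable.lintegral_prod_right
      ((measurable_lintegral_Ioc_kernel hκ τ).mul (ih.comp measurable_snd))

/-- Restricting every time increment to `(0, τ]` bounds the iterates of the Volterra operator
from below. -/
theorem iterate_timeIntegratedOp_le_iterate_volterraOp [SFinite μ]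
    (hκ : Measurable fun z : ℝ × X × X => κ z.1 z.2.1 z.2.2) {τ : ℝ} (hτ : 0 ≤ τ) (j : ℕ)
    {t : ℝ} (ht : j * τ ≤ t) (x : X) :
    (timeIntegratedOp κ μ τ)^[j] 1 x ≤ (volterraOp κ μ)^[j] 1 t x := by
  induction j generalizing t x with
  | zero => exact le_rfl
  | succ j ih =>
    rw [iterate_succ_apply', iterate_succ_apply']
    set F := (timeIntegratedOp κ μ τ)^[j] 1
    have hF : Measurable F := measurable_iterate_timeIntegratedOp hκ τ j
    have hkx : Measurable fun z : X × ℝ => κ z.2 x z.1 :=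
      hκ.comp (by fun_prop : Measurable fun z : X × ℝ => (z.2, x, z.1))
    calc timeIntegratedOp κ μ τ F x
        = ∫⁻ y, (∫⁻ r in Set.Ioc 0 τ, κ r x y * F y) ∂μ := by
          refine lintegral_congr fun y => (lintegral_mul_const _ ?_).symm
          exact hkx.comp measurable_prodMk_left
      _ = ∫⁻ r in Set.Ioc 0 τ, ∫⁻ y, κ r x y * F y ∂μ :=
          lintegral_lintegral_swap (hkx.mul (hF.comp measurable_fst)).aemeasurable
      _ = ∫⁻ r in Set.Ioo 0 τ, ∫⁻ y, κ r x y * F y ∂μ :=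
          (setLIntegral_congr Ioo_ae_eq_Ioc).symm
      _ = ∫⁻ s, (Set.Ioo 0 τ).indicator (fun r => ∫⁻ y, κ r x y * F y ∂μ) (t - s) := by
          rw [lintegral_sub_left_eq_self, lintegral_indicator measurableSet_Ioo]
      _ ≤ ∫⁻ s, (Set.Ioc 0 t).indicator
            (fun s => ∫⁻ y, κ (t - s) x y * (volterraOp κ μ)^[j] 1 s y ∂μ) s := by
          refine lintegral_mono fun s => ?_
          by_cases hs : t - s ∈ Set.Ioo 0 τ
          · have h1 : j * τ ≤ s := by
              push_cast at ht
              linarith [hs.2]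
            have hs' : s ∈ Set.Ioc 0 t := by
              push_cast at ht
              have : 0 ≤ j * τ := by positivity
              exact ⟨by linarith [hs.2], by linarith [hs.1]⟩
            rw [Set.indicator_of_mem hs, Set.indicator_of_mem hs']
            exact lintegral_mono fun y => mul_le_mul_right (ih h1 y) _
          · rw [Set.indicator_of_notMem hs]
            exact zero_le
      _ = volterraOp κ μ ((volterraOp κ μ)^[j] 1) t x := by
          rw [lintegral_indicator measurableSet_Ioc]
          rfl

/-- If `∫ κ_s(x,y) dμ(y)` is bounded by a function of `s`, uniformly in `x`, then the iterates
of the Volterra operator are bounded by powers of the integral of that function. -/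
theorem iterate_volterraOp_le {S : Set X} (hS : ∀ᵐ y ∂μ, y ∈ S) {T : ℝ} {g : ℝ → ENNReal}
    (hg : ∀ s ∈ Set.Ioc 0 T, ∀ x ∈ S, ∫⁻ y, κ s x y ∂μ ≤ g s) (hgm : Measurable g)
    (hκ : Measurable fun z : ℝ × X × X => κ z.1 z.2.1 z.2.2) (j : ℕ) {t : ℝ}
    (ht : t ≤ T) {x : X} (hx : x ∈ S) :
    (volterraOp κ μ)^[j] 1 t x ≤ (∫⁻ s in Set.Ioc 0 T, g s) ^ j := by
  induction j generalizing t x with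
  | zero => simp
  | succ j ih =>
    rw [iterate_succ_apply', volterraOp]
    set G := ∫⁻ s in Set.Ioc 0 T, g s
    have hinner : ∀ s ∈ Set.Ioo 0 t,
        ∫⁻ y, κ (t - s) x y * (volterraOp κ μ)^[j] 1 s y ∂μ ≤ g (t - s) * G ^ j := by
      intro s hs
      calc ∫⁻ y, κ (t - s) x y * (volterraOp κ μ)^[j] 1 s y ∂μ
          ≤ ∫⁻ y, κ (t - s) x y * G ^ j ∂μ := by
            refine lintegral_mono_ae ?_
            filter_upwards [hS] with y hy
            exact mul_le_mul_right (ih (hs.2.le.trans ht) hy) _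
        _ = (∫⁻ y, κ (t - s) x y ∂μ) * G ^ j :=
            lintegral_mul_const _
              (hκ.comp (by fun_prop : Measurable fun y : X => (t - s, x, y)))
        _ ≤ g (t - s) * G ^ j :=
            mul_le_mul_left
              (hg _ ⟨by linarith [hs.2], by linarith [hs.1]⟩ _ hx) _
    calc ∫⁻ s in Set.Ioc 0 t, ∫⁻ y, κ (t - s) x y * (volterraOp κ μ)^[j] 1 s y ∂μ
        = ∫⁻ s in Set.Ioo 0 t, ∫⁻ y, κ (t - s) x y * (volterraOp κ μ)^[j] 1 s y ∂μ :=
          (setLIntegral_congr Ioo_ae_eq_Ioc).symm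
      _ ≤ ∫⁻ s in Set.Ioo 0 t, g (t - s) * G ^ j := setLIntegral_mono' measurableSet_Ioo hinner
      _ = (∫⁻ s in Set.Ioo 0 t, g (t - s)) * G ^ j := lintegral_mul_const _ (by fun_prop)
      _ ≤ G * G ^ j := by
          refine mul_le_mul_left ?_ _
          rw [← lintegral_indicator measurableSet_Ioo, ← lintegral_sub_left_eq_self _ t,
            show G = _ from (lintegral_indicator measurableSet_Ioc g).symm]
          refine lintegral_mono fun s => ?_
          by_cases hs : t - s ∈ Set.Ioo 0 t
          · have hs' : s ∈ Set.Ioc 0 T := ⟨by linarith [hs.2], by linarith [hs.1]⟩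
            rw [Set.indicator_of_mem hs, Set.indicator_of_mem hs', sub_sub_cancel]
          · rw [Set.indicator_of_notMem hs]
            exact zero_le
      _ = G ^ (j + 1) := (pow_succ' _ _).symm

end VolterraOperator

section NeumannKernel

theorem heatGauss_nonneg (s z : ℝ) : 0 ≤ heatGauss s z := by
  unfold heatGauss
  positivity

theorem heatGauss_neg (s z : ℝ) : heatGauss s (-z) = heatGauss s z := by
  simp only [heatGauss, neg_sq]

theorem neumannHeatKernel_nonneg (L s x y : ℝ) : 0 ≤ neumannHeatKernel L s x y :=
  tsum_nonneg fun _ => add_nonneg (heatGauss_nonneg _ _) (heatGauss_nonneg _ _)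

theorem measurable_neumannHeatKernel (L : ℝ) :
    Measurable fun z : ℝ × ℝ × ℝ => neumannHeatKernel L z.1 z.2.1 z.2.2 := by
  have hterm : ∀ n : ℤ, Measurable fun z : ℝ × ℝ × ℝ =>
      heatGauss z.1 (z.2.1 - z.2.2 - 2 * (n : ℝ) * L)
        + heatGauss z.1 (z.2.1 + z.2.2 - 2 * (n : ℝ) * L) := fun n => by
    unfold heatGauss
    fun_prop
  exact Measurable.tsum hterm

/-- Coefficients controlling the contribution of the `n`-th image up to time `T`. -/
noncomputable def imageWeight (L T : ℝ) (n : ℤ) : ℝ :=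
  exp (L ^ 2 / (2 * T)) * exp (-(L ^ 2 / (4 * T)) * (n : ℝ) ^ 2)

theorem summable_imageWeight {L T : ℝ} (hL : 0 < L) (hT : 0 < T) :
    Summable (imageWeight L T) := by
  have h := summable_pow_mul_jacobiTheta₂_term_bound 0
    (T := L ^ 2 / (4 * T) / π) (by positivity) 0
  refine (h.mul_left (exp (L ^ 2 / (2 * T)))).congr fun n => ?_
  have : -π * (L ^ 2 / (4 * T) / π * (n : ℝ) ^ 2 - 2 * 0 * ((|n| : ℤ) : ℝ))
      = -(L ^ 2 / (4 * T)) * (n : ℝ) ^ 2 := by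
    field_simp
    ring
  rw [imageWeight, pow_zero, one_mul, this]

theorem imageWeight_pos (L T : ℝ) (n : ℤ) : 0 < imageWeight L T n := by
  unfold imageWeight
  positivity

theorem heatGauss_image_le {L T s z : ℝ} (hs : s ∈ Set.Ioc 0 T) (hz : |z| ≤ 2 * L) (n : ℤ) :
    heatGauss s (z - 2 * n * L) ≤
      imageWeight L T n * (exp (-(1 / (8 * s)) * (z - 2 * n * L) ^ 2) / √(4 * π * s)) := by
  have hs0 : 0 < s := hs.1
  have hT0 : 0 < T := hs.1.trans_le hs.2
  set w := z - 2 * n * L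
  rw [heatGauss, ← mul_div_assoc]
  refine div_le_div_of_nonneg_right ?_ (sqrt_nonneg _)
  rw [imageWeight, ← exp_add, ← exp_add, exp_le_exp]
  have hw1 : 2 * L ^ 2 * (n : ℝ) ^ 2 - 4 * L ^ 2 ≤ w ^ 2 := by
    have : z ^ 2 ≤ (2 * L) ^ 2 := sq_le_sq' (by linarith [neg_abs_le z]) ((le_abs_self z).trans hz)
    nlinarith [sq_nonneg (2 * z - 2 * n * L)]
  have hw2 : w ^ 2 / (8 * T) ≤ w ^ 2 / (8 * s) :=
    div_le_div_of_nonneg_left (sq_nonneg _) (by positivity) (by linarith [hs.2])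
  have hw3 : (2 * L ^ 2 * (n : ℝ) ^ 2 - 4 * L ^ 2) / (8 * T) ≤ w ^ 2 / (8 * T) :=
    div_le_div_of_nonneg_right hw1 (by positivity)
  have e1 : (2 * L ^ 2 * (n : ℝ) ^ 2 - 4 * L ^ 2) / (8 * T)
      = L ^ 2 / (4 * T) * (n : ℝ) ^ 2 - L ^ 2 / (2 * T) := by
    field_simp
    ring
  have e2 : -w ^ 2 / (4 * s) = -(w ^ 2 / (8 * s)) - w ^ 2 / (8 * s) := by
    field_simp
    ring
  have e3 : -(1 / (8 * s)) * w ^ 2 = -(w ^ 2 / (8 * s)) := by ring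
  rw [e2, e3]
  linarith

theorem summable_heatGauss_image {L s z : ℝ} (hL : 0 < L) (hs : 0 < s) (hz : |z| ≤ 2 * L) :
    Summable fun n : ℤ => heatGauss s (z - 2 * n * L) := by
  refine Summable.of_nonneg_of_le (fun n => heatGauss_nonneg _ _) (fun n => ?_)
    ((summable_imageWeight hL hs).mul_right (1 / √(4 * π * s)))
  refine (heatGauss_image_le (T := s) ⟨hs, le_rfl⟩ hz n).trans ?_
  refine mul_le_mul_of_nonneg_left ?_ (imageWeight_pos L s n).le
  refine div_le_div_of_nonneg_right (exp_le_one_iff.2 ?_) (sqrt_nonneg _)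
  rw [neg_mul]
  exact neg_nonpos.2 (by positivity)

theorem abs_sub_le_two_mul {L x y : ℝ} (hx : x ∈ Set.Icc 0 L) (hy : y ∈ Set.Icc 0 L) :
    |x - y| ≤ 2 * L := by
  rw [abs_le]
  constructor <;> linarith [hx.1, hx.2, hy.1, hy.2]

theorem abs_add_le_two_mul {L x y : ℝ} (hx : x ∈ Set.Icc 0 L) (hy : y ∈ Set.Icc 0 L) :
    |x + y| ≤ 2 * L := by
  rw [abs_le]
  constructor <;> linarith [hx.1, hx.2, hy.1, hy.2]

theorem summable_neumannHeatKernel {L s x y : ℝ} (hL : 0 < L) (hs : 0 < s)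
    (hx : x ∈ Set.Icc 0 L) (hy : y ∈ Set.Icc 0 L) :
    Summable fun n : ℤ =>
      heatGauss s (x - y - 2 * (n : ℝ) * L) + heatGauss s (x + y - 2 * (n : ℝ) * L) :=
  (summable_heatGauss_image hL hs (abs_sub_le_two_mul hx hy)).add
    (summable_heatGauss_image hL hs (abs_add_le_two_mul hx hy))

theorem neumannHeatKernel_eq_toReal (L s x y : ℝ) :
    neumannHeatKernel L s x y =
      (∑' n : ℤ, ENNReal.ofReal (heatGauss s (x - y - 2 * (n : ℝ) * L))
        + ∑' n : ℤ, ENNReal.ofReal (heatGauss s (x + y - 2 * (n : ℝ) * L))).toReal := by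
  rw [← ENNReal.tsum_add, ENNReal.tsum_toReal_eq fun _ => by finiteness]
  refine tsum_congr fun n => ?_
  rw [← ENNReal.ofReal_add (heatGauss_nonneg _ _) (heatGauss_nonneg _ _),
    ENNReal.toReal_ofReal (add_nonneg (heatGauss_nonneg _ _) (heatGauss_nonneg _ _))]

theorem neumannHeatKernel_symm (L s x y : ℝ) :
    neumannHeatKernel L s x y = neumannHeatKernel L s y x := by
  rw [neumannHeatKernel_eq_toReal, neumannHeatKernel_eq_toReal, add_comm y x]
  congr 2
  rw [← (Equiv.neg ℤ).tsum_eq]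
  refine tsum_congr fun n => ?_
  rw [← heatGauss_neg]
  congr 2
  push_cast [Equiv.neg_apply]
  ring

theorem heatGauss_le_neumannHeatKernel {L s x y : ℝ} (hL : 0 < L) (hs : 0 < s)
    (hx : x ∈ Set.Icc 0 L) (hy : y ∈ Set.Icc 0 L) :
    heatGauss s (x - y) ≤ neumannHeatKernel L s x y := by
  have h := (summable_neumannHeatKernel hL hs hx hy).le_tsum 0
    fun _ _ => add_nonneg (heatGauss_nonneg _ _) (heatGauss_nonneg _ _)
  refine le_trans ?_ h
  simpa using heatGauss_nonneg s (x + y)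

theorem neumannHeatKernel_le {L T s x y : ℝ} (hL : 0 < L) (hs : s ∈ Set.Ioc 0 T)
    (hx : x ∈ Set.Icc 0 L) (hy : y ∈ Set.Icc 0 L) :
    neumannHeatKernel L s x y ≤ 2 * (∑' n, imageWeight L T n) / √(4 * π * s) := by
  have hT : 0 < T := hs.1.trans_le hs.2
  have hle : ∀ z : ℝ, |z| ≤ 2 * L → ∀ n : ℤ,
      heatGauss s (z - 2 * n * L) ≤ imageWeight L T n * (1 / √(4 * π * s)) := by
    intro z hz n
    refine (heatGauss_image_le hs hz n).trans ?_
    refine mul_le_mul_of_nonneg_left ?_ (imageWeight_pos L T n).le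
    refine div_le_div_of_nonneg_right (exp_le_one_iff.2 ?_) (sqrt_nonneg _)
    have := hs.1
    rw [neg_mul]
    exact neg_nonpos.2 (by positivity)
  have hsum := (summable_imageWeight hL hT).mul_right (1 / √(4 * π * s))
  calc neumannHeatKernel L s x y
      ≤ ∑' n : ℤ, (imageWeight L T n * (1 / √(4 * π * s))
          + imageWeight L T n * (1 / √(4 * π * s))) :=
        (summable_neumannHeatKernel hL hs.1 hx hy).tsum_le_tsum
          (fun n => add_le_add (hle _ (abs_sub_le_two_mul hx hy) n)
            (hle _ (abs_add_le_two_mul hx hy) n)) (hsum.add hsum)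
    _ = _ := by
        rw [hsum.tsum_add hsum, tsum_mul_right]
        ring

theorem lintegral_gaussian_eight {s : ℝ} (hs : 0 < s) :
    ∫⁻ w : ℝ, ENNReal.ofReal (exp (-(1 / (8 * s)) * w ^ 2) / √(4 * π * s))
      = ENNReal.ofReal (√2) := by
  rw [← ofReal_integral_eq_lintegral_ofReal
    ((integrable_exp_neg_mul_sq (by positivity)).div_const _)
    (.of_forall fun w => by positivity), integral_div, integral_gaussian,
    ← Real.sqrt_div (by positivity)]
  congr 2
  field_simp
  ring

theorem lintegral_neumannHeatKernel_le {L T s x : ℝ} (hL : 0 < L) (hs : s ∈ Set.Ioc 0 T)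
    (hx : x ∈ Set.Icc 0 L) :
    ∫⁻ y in Set.Ioc 0 L, ENNReal.ofReal (neumannHeatKernel L s x y) ≤
      ENNReal.ofReal ((∑' n, imageWeight L T n) * (2 * √2)) := by
  have hT : 0 < T := hs.1.trans_le hs.2
  set e : ℝ → ℝ := fun w => exp (-(1 / (8 * s)) * w ^ 2) / √(4 * π * s)
  have he0 : ∀ w, 0 ≤ e w := fun w => by positivity
  have hem : Measurable e := by fun_prop
  have hpt : ∀ y ∈ Set.Ioc 0 L, ENNReal.ofReal (neumannHeatKernel L s x y) ≤
      ∑' n : ℤ, ENNReal.ofReal (imageWeight L T n) *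
        (ENNReal.ofReal (e (x - y - 2 * n * L)) + ENNReal.ofReal (e (x + y - 2 * n * L))) := by
    intro y hy
    have hy' : y ∈ Set.Icc 0 L := ⟨hy.1.le, hy.2⟩
    rw [neumannHeatKernel, ENNReal.ofReal_tsum_of_nonneg
      (fun _ => add_nonneg (heatGauss_nonneg _ _) (heatGauss_nonneg _ _))
      (summable_neumannHeatKernel hL hs.1 hx hy')]
    refine ENNReal.tsum_le_tsum fun n => ?_
    rw [← ENNReal.ofReal_add (he0 _) (he0 _), ← ENNReal.ofReal_mul (imageWeight_pos L T n).le,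
      mul_add]
    exact ENNReal.ofReal_le_ofReal (add_le_add
      (heatGauss_image_le hs (abs_sub_le_two_mul hx hy') n)
      (heatGauss_image_le hs (abs_add_le_two_mul hx hy') n))
  calc ∫⁻ y in Set.Ioc 0 L, ENNReal.ofReal (neumannHeatKernel L s x y)
      ≤ ∫⁻ y in Set.Ioc 0 L, ∑' n : ℤ, ENNReal.ofReal (imageWeight L T n) *
        (ENNReal.ofReal (e (x - y - 2 * n * L)) + ENNReal.ofReal (e (x + y - 2 * n * L))) :=
        setLIntegral_mono' measurableSet_Ioc hpt
    _ ≤ ∫⁻ y, ∑' n : ℤ, ENNReal.ofReal (imageWeight L T n) *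
        (ENNReal.ofReal (e (x - y - 2 * n * L)) + ENNReal.ofReal (e (x + y - 2 * n * L))) :=
        setLIntegral_le_lintegral _ _
    _ = ∑' n : ℤ, ENNReal.ofReal (imageWeight L T n) * ENNReal.ofReal (2 * √2) := by
        rw [lintegral_tsum fun n => by fun_prop]
        refine tsum_congr fun n => ?_
        rw [lintegral_const_mul _ (by fun_prop), lintegral_add_left (by fun_prop)]
        have h1 : ∫⁻ y, ENNReal.ofReal (e (x - y - 2 * n * L)) = ENNReal.ofReal (√2) := by
          rw [← lintegral_gaussian_eight hs.1,
            ← lintegral_sub_left_eq_self (fun w => ENNReal.ofReal (e w)) (x - 2 * n * L)]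
          exact lintegral_congr fun y => by ring_nf
        have h2 : ∫⁻ y, ENNReal.ofReal (e (x + y - 2 * n * L)) = ENNReal.ofReal (√2) := by
          rw [← lintegral_gaussian_eight hs.1,
            ← lintegral_add_left_eq_self (fun w => ENNReal.ofReal (e w)) (x - 2 * n * L)]
          exact lintegral_congr fun y => by ring_nf
        rw [h1, h2, ← ENNReal.ofReal_add (sqrt_nonneg _) (sqrt_nonneg _), ← two_mul]
    _ = _ := by
        rw [ENNReal.tsum_mul_right, ← ENNReal.ofReal_tsum_of_nonneg
          (fun n => (imageWeight_pos L T n).le) (summable_imageWeight hL hT),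
          ← ENNReal.ofReal_mul (tsum_nonneg fun n => (imageWeight_pos L T n).le)]

/-- The squared Neumann heat kernel as an extended nonnegative kernel. -/
noncomputable def neumannSqKernel (L s x y : ℝ) : ENNReal :=
  ENNReal.ofReal (neumannHeatKernel L s x y ^ 2)

theorem toReal_neumannSqKernel (L s x y : ℝ) :
    (neumannSqKernel L s x y).toReal = neumannHeatKernel L s x y ^ 2 :=
  ENNReal.toReal_ofReal (sq_nonneg _)

theorem neumannSqKernel_lt_top (L s x y : ℝ) : neumannSqKernel L s x y < ⊤ :=
  ENNReal.ofReal_lt_top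

theorem neumannSqKernel_symm (L s x y : ℝ) :
    neumannSqKernel L s x y = neumannSqKernel L s y x := by
  rw [neumannSqKernel, neumannSqKernel, neumannHeatKernel_symm]

theorem measurable_neumannSqKernel (L : ℝ) :
    Measurable fun z : ℝ × ℝ × ℝ => neumannSqKernel L z.1 z.2.1 z.2.2 :=
  ((measurable_neumannHeatKernel L).pow_const 2).ennreal_ofReal

/-- An integrable bound for `∫₀ᴸ p_s(x,y)² dy` on `(0, T]`, uniform in `x`. -/
noncomputable def neumannSqBound (L T s : ℝ) : ENNReal :=
  ENNReal.ofReal (2 * (∑' n, imageWeight L T n) / √(4 * π * s)) *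
    ENNReal.ofReal ((∑' n, imageWeight L T n) * (2 * √2))

theorem neumannSqBound_lt_top (L T s : ℝ) : neumannSqBound L T s < ⊤ :=
  ENNReal.mul_lt_top ENNReal.ofReal_lt_top ENNReal.ofReal_lt_top

theorem measurable_neumannSqBound (L T : ℝ) : Measurable (neumannSqBound L T) := by
  unfold neumannSqBound
  fun_prop

theorem lintegral_neumannSqKernel_le {L T s x : ℝ} (hL : 0 < L) (hs : s ∈ Set.Ioc 0 T)
    (hx : x ∈ Set.Icc 0 L) :
    ∫⁻ y in Set.Ioc 0 L, neumannSqKernel L s x y ≤ neumannSqBound L T s := by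
  refine le_trans ?_ (mul_le_mul_right (lintegral_neumannHeatKernel_le hL hs hx) _)
  rw [← lintegral_const_mul' _ _ ENNReal.ofReal_ne_top]
  refine setLIntegral_mono' measurableSet_Ioc fun y hy => ?_
  have h0 := neumannHeatKernel_nonneg L s x y
  rw [neumannSqKernel, sq, ENNReal.ofReal_mul h0]
  exact mul_le_mul_left (ENNReal.ofReal_le_ofReal
    (neumannHeatKernel_le hL hs hx ⟨hy.1.le, hy.2⟩)) _

theorem lintegral_neumannSqBound_lt_top (L T : ℝ) :
    ∫⁻ s in Set.Ioc 0 T, neumannSqBound L T s < ⊤ := by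
  unfold neumannSqBound
  rw [lintegral_mul_const' _ _ ENNReal.ofReal_ne_top]
  refine ENNReal.mul_lt_top ?_ ENNReal.ofReal_lt_top
  have hinteg : IntegrableOn (fun s : ℝ => 2 * (∑' n, imageWeight L T n) / √(4 * π * s))
      (Set.Ioc 0 T) := by
    have h := ((intervalIntegral.intervalIntegrable_rpow' (a := 0) (b := T)
      (by norm_num : (-1 : ℝ) < -(1 / 2))).1).const_mul
        (2 * (∑' n, imageWeight L T n) / √(4 * π))
    refine IntegrableOn.congr_fun h (fun s hs => ?_) measurableSet_Ioc
    rw [Real.sqrt_mul (by positivity : (0 : ℝ) ≤ 4 * π) s, Real.rpow_neg hs.1.le,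
      ← Real.sqrt_eq_rpow]
    field_simp
  exact hinteg.lintegral_lt_top

theorem ofReal_sq_le_neumannSqKernel {L s x y c : ℝ} (hL : 0 < L) (hs : 0 < s)
    (hx : x ∈ Set.Icc 0 L) (hy : y ∈ Set.Icc 0 L) (hc : 0 ≤ c) (hle : c ≤ heatGauss s (x - y)) :
    ENNReal.ofReal (c ^ 2) ≤ neumannSqKernel L s x y :=
  ENNReal.ofReal_le_ofReal
    (pow_le_pow_left₀ hc (hle.trans (heatGauss_le_neumannHeatKernel hL hs hx hy)) 2)

attribute [irreducible] neumannSqKernel neumannSqBound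

end NeumannKernel

section LowerBound

theorem ae_mem_Icc_restrict_Ioc (L : ℝ) :
    ∀ᵐ y ∂(volume.restrict (Set.Ioc 0 L)), y ∈ Set.Icc 0 L :=
  (ae_restrict_mem measurableSet_Ioc).mono fun _ hy => ⟨hy.1.le, hy.2⟩

theorem iterate_volterraOp_neumannSqKernel_le {L : ℝ} (hL : 0 < L) (j : ℕ) (t : ℝ) {x : ℝ}
    (hx : x ∈ Set.Icc 0 L) :
    (volterraOp (neumannSqKernel L) (volume.restrict (Set.Ioc 0 L)))^[j] 1 t x ≤
      (∫⁻ s in Set.Ioc 0 t, neumannSqBound L t s) ^ j :=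
  iterate_volterraOp_le (κ := neumannSqKernel L) (ae_mem_Icc_restrict_Ioc L)
    (fun _ hs _ hx => lintegral_neumannSqKernel_le hL hs hx) (measurable_neumannSqBound L t)
    (measurable_neumannSqKernel L) j le_rfl hx

theorem iterate_volterraOp_neumannSqKernel_lt_top {L : ℝ} (hL : 0 < L) (j : ℕ) (t : ℝ) {x : ℝ}
    (hx : x ∈ Set.Icc 0 L) :
    (volterraOp (neumannSqKernel L) (volume.restrict (Set.Ioc 0 L)))^[j] 1 t x < ⊤ :=
  (iterate_volterraOp_neumannSqKernel_le hL j t hx).trans_lt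
    (ENNReal.pow_lt_top (lintegral_neumannSqBound_lt_top L t))

theorem iterate_heatSqOp_eq_toReal {L : ℝ} (hL : 0 < L) (j : ℕ) {t x : ℝ} (ht : 0 ≤ t)
    (hx : x ∈ Set.Icc 0 L) :
    (heatSqOp L)^[j] (fun _ _ => (1 : ℝ)) t x =
      ((volterraOp (neumannSqKernel L) (volume.restrict (Set.Ioc 0 L)))^[j] 1 t x).toReal := by
  induction j generalizing t x with
  | zero => simp
  | succ j ih =>
    have hfin := iterate_volterraOp_neumannSqKernel_lt_top hL (j + 1) t hx
    rw [iterate_succ_apply'] at hfin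
    rw [iterate_succ_apply', iterate_succ_apply']
    set μ := volume.restrict (Set.Ioc 0 L) with hμ
    set F := (volterraOp (neumannSqKernel L) μ)^[j] 1
    have hFm : Measurable (uncurry F) :=
      measurable_iterate_volterraOp (measurable_neumannSqKernel L) j
    have hprod : Measurable fun z : ℝ × ℝ => neumannSqKernel L (t - z.1) x z.2 * F z.1 z.2 :=
      ((measurable_neumannSqKernel L).comp
        (by fun_prop : Measurable fun z : ℝ × ℝ => (t - z.1, x, z.2))).mul hFm
    have hinnerm : Measurable fun s => ∫⁻ y, neumannSqKernel L (t - s) x y * F s y ∂μ :=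
      hprod.lintegral_prod_right'
    have hinner : ∀ s ∈ Set.Ioc 0 t,
        ∫ y in (0 : ℝ)..L, neumannHeatKernel L (t - s) x y ^ 2
            * (heatSqOp L)^[j] (fun _ _ => (1 : ℝ)) s y
          = (∫⁻ y, neumannSqKernel L (t - s) x y * F s y ∂μ).toReal := by
      intro s hs
      rw [intervalIntegral.integral_of_le hL.le, ← hμ, ← integral_toReal]
      · refine integral_congr_ae ?_
        filter_upwards [ae_mem_Icc_restrict_Ioc L] with y hy
        rw [ENNReal.toReal_mul, toReal_neumannSqKernel, ih hs.1.le hy]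
      · exact (hprod.comp measurable_prodMk_left).aemeasurable
      · filter_upwards [ae_mem_Icc_restrict_Ioc L] with y hy
        exact ENNReal.mul_lt_top (neumannSqKernel_lt_top _ _ _ _)
          (iterate_volterraOp_neumannSqKernel_lt_top hL j s hy)
    rw [heatSqOp, volterraOp, intervalIntegral.integral_of_le ht, ← integral_toReal]
    · exact setIntegral_congr_fun measurableSet_Ioc hinner
    · exact hinnerm.aemeasurable
    · exact ae_lt_top hinnerm hfin.ne

/-- The kernel `∫₀^τ p_r(x,y)² dr`. -/
noncomputable def timeIntegratedSqKernel (L τ x y : ℝ) : ℝ :=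
  (∫⁻ r in Set.Ioc 0 τ, neumannSqKernel L r x y).toReal

theorem lintegral_timeIntegratedSqKernel_swap (L τ x : ℝ) :
    ∫⁻ y in Set.Ioc 0 L, ∫⁻ r in Set.Ioc 0 τ, neumannSqKernel L r x y =
      ∫⁻ r in Set.Ioc 0 τ, ∫⁻ y in Set.Ioc 0 L, neumannSqKernel L r x y :=
  lintegral_lintegral_swap ((measurable_neumannSqKernel L).comp
    (by fun_prop : Measurable fun z : ℝ × ℝ => (z.2, x, z.1))).aemeasurable

theorem lintegral_timeIntegratedSqKernel_le {L : ℝ} (hL : 0 < L) (τ : ℝ) {x : ℝ}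
    (hx : x ∈ Set.Icc 0 L) :
    ∫⁻ y in Set.Ioc 0 L, ∫⁻ r in Set.Ioc 0 τ, neumannSqKernel L r x y ≤
      ∫⁻ s in Set.Ioc 0 τ, neumannSqBound L τ s := by
  rw [lintegral_timeIntegratedSqKernel_swap]
  exact setLIntegral_mono' measurableSet_Ioc fun r hr => lintegral_neumannSqKernel_le hL hr hx

theorem integral_timeIntegratedSqKernel_eq {L : ℝ} (hL : 0 < L) (τ : ℝ) {x : ℝ}
    (hx : x ∈ Set.Icc 0 L) :
    ∫ y in Set.Ioc 0 L, timeIntegratedSqKernel L τ x y =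
      (∫⁻ y in Set.Ioc 0 L, ∫⁻ r in Set.Ioc 0 τ, neumannSqKernel L r x y).toReal := by
  have hm : Measurable fun y => ∫⁻ r in Set.Ioc 0 τ, neumannSqKernel L r x y :=
    (measurable_lintegral_Ioc_kernel (measurable_neumannSqKernel L) τ).comp
      measurable_prodMk_left
  exact integral_toReal hm.aemeasurable (ae_lt_top hm
    ((lintegral_timeIntegratedSqKernel_le hL τ hx).trans_lt
      (lintegral_neumannSqBound_lt_top L τ)).ne)

theorem exists_pos_le_integral_timeIntegratedSqKernel {L τ : ℝ} (hL : 0 < L) (hτ : 0 < τ) :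
    ∃ m > 0, ∀ x ∈ Set.Icc 0 L, m ≤ ∫ y in Set.Ioc 0 L, timeIntegratedSqKernel L τ x y := by
  set c : ℝ := exp (-L ^ 2 / (2 * τ)) / √(4 * π * τ) with hc
  have hcpos : 0 < c := by positivity
  refine ⟨c ^ 2 * (τ / 2) * L, by positivity, fun x hx => ?_⟩
  rw [integral_timeIntegratedSqKernel_eq hL τ hx]
  refine (ENNReal.ofReal_le_iff_le_toReal ((lintegral_timeIntegratedSqKernel_le hL τ hx).trans_lt
    (lintegral_neumannSqBound_lt_top L τ)).ne).1 ?_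
  have hpt : ∀ y ∈ Set.Ioc 0 L, ENNReal.ofReal (c ^ 2 * (τ / 2)) ≤
      ∫⁻ r in Set.Ioc 0 τ, neumannSqKernel L r x y := by
    intro y hy
    have hr : ∀ r ∈ Set.Ioc (τ / 2) τ, ENNReal.ofReal (c ^ 2) ≤ neumannSqKernel L r x y := by
      intro r hr
      have hr0 : 0 < r := by linarith [hr.1]
      refine ofReal_sq_le_neumannSqKernel hL hr0 hx ⟨hy.1.le, hy.2⟩ hcpos.le ?_
      have hsq : (x - y) ^ 2 ≤ L ^ 2 :=
        sq_le_sq' (by linarith [hx.1, hy.2]) (by linarith [hx.2, hy.1])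
      rw [hc, heatGauss]
      refine div_le_div₀ (exp_pos _).le (exp_le_exp.2 ?_) (by positivity)
        (Real.sqrt_le_sqrt (mul_le_mul_of_nonneg_left hr.2 (by positivity)))
      rw [neg_div, neg_div, neg_le_neg_iff]
      exact div_le_div₀ (sq_nonneg _) hsq (by positivity) (by linarith [hr.1])
    calc ENNReal.ofReal (c ^ 2 * (τ / 2))
        = ∫⁻ _ in Set.Ioc (τ / 2) τ, ENNReal.ofReal (c ^ 2) := by
          rw [setLIntegral_const, Real.volume_Ioc, ← ENNReal.ofReal_mul (sq_nonneg c)]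
          congr 2
          ring
      _ ≤ ∫⁻ r in Set.Ioc (τ / 2) τ, neumannSqKernel L r x y :=
          setLIntegral_mono' measurableSet_Ioc hr
      _ ≤ _ := lintegral_mono_set (Set.Ioc_subset_Ioc_left (by linarith))
  calc ENNReal.ofReal (c ^ 2 * (τ / 2) * L)
      = ∫⁻ _ in Set.Ioc 0 L, ENNReal.ofReal (c ^ 2 * (τ / 2)) := by
        rw [setLIntegral_const, Real.volume_Ioc, sub_zero, ← ENNReal.ofReal_mul (by positivity)]
    _ ≤ _ := setLIntegral_mono' measurableSet_Ioc hpt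

theorem neumannPhi_eq_integral_timeIntegratedSqKernel {L τ : ℝ} (hL : 0 < L) (hτ : 0 < τ) :
    neumannPhi L τ =
      ∫ x in Set.Ioc 0 L, ∫ y in Set.Ioc 0 L, timeIntegratedSqKernel L τ x y := by
  have hκ := measurable_neumannSqKernel L
  set μ := volume.restrict (Set.Ioc 0 L) with hμ
  have hGfin := lintegral_neumannSqBound_lt_top L τ
  have hin : ∀ s, Measurable fun y => ∫⁻ x, neumannSqKernel L s x y ∂μ := fun s =>
    Measurable.lintegral_prod_right' (f := fun z : ℝ × ℝ => neumannSqKernel L s z.2 z.1)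
      (hκ.comp (by fun_prop : Measurable fun z : ℝ × ℝ => (s, z.2, z.1)))
  have hmid : Measurable fun s => ∫⁻ y, ∫⁻ x, neumannSqKernel L s x y ∂μ ∂μ := by
    refine Measurable.lintegral_prod_right'
      (f := fun z : ℝ × ℝ => ∫⁻ x, neumannSqKernel L z.1 x z.2 ∂μ) ?_
    exact Measurable.lintegral_prod_right'
      (f := fun z : (ℝ × ℝ) × ℝ => neumannSqKernel L z.1.1 z.2 z.1.2)
      (hκ.comp (by fun_prop : Measurable fun z : (ℝ × ℝ) × ℝ => (z.1.1, z.2, z.1.2)))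
  have hxm : ∀ s, Measurable (uncurry fun x y => neumannSqKernel L s x y) := fun s =>
    hκ.comp (by fun_prop : Measurable fun z : ℝ × ℝ => (s, z.1, z.2))
  have hbound : ∀ s ∈ Set.Ioc 0 τ,
      ∫⁻ y, ∫⁻ x, neumannSqKernel L s x y ∂μ ∂μ < ⊤ := by
    intro s hs
    rw [← lintegral_lintegral_swap (hxm s).aemeasurable]
    calc ∫⁻ x, ∫⁻ y, neumannSqKernel L s x y ∂μ ∂μ
        ≤ ∫⁻ _, neumannSqBound L τ s ∂μ := by
          refine lintegral_mono_ae ?_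
          filter_upwards [ae_mem_Icc_restrict_Ioc L] with x hx
          exact lintegral_neumannSqKernel_le hL hs hx
      _ < ⊤ := by
          rw [lintegral_const]
          exact ENNReal.mul_lt_top (neumannSqBound_lt_top _ _ _) (measure_lt_top _ _)
  have hlhs : neumannPhi L τ =
      (∫⁻ s in Set.Ioc 0 τ, ∫⁻ y, ∫⁻ x, neumannSqKernel L s x y ∂μ ∂μ).toReal := by
    rw [neumannPhi, intervalIntegral.integral_of_le hτ.le, ← integral_toReal hmid.aemeasurable
      ((ae_restrict_mem measurableSet_Ioc).mono hbound)]
    refine setIntegral_congr_fun measurableSet_Ioc fun s hs => ?_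
    rw [intervalIntegral.integral_of_le hL.le, ← hμ, ← integral_toReal (hin s).aemeasurable
      (ae_lt_top (hin s) (hbound s hs).ne)]
    refine integral_congr_ae (.of_forall fun y => ?_)
    beta_reduce
    rw [intervalIntegral.integral_of_le hL.le, ← hμ, ← integral_toReal]
    · simp only [toReal_neumannSqKernel]
    · exact ((hxm s).comp measurable_prodMk_right).aemeasurable
    · exact .of_forall fun _ => neumannSqKernel_lt_top _ _ _ _
  have hqm : Measurable fun x => ∫⁻ y, (∫⁻ r in Set.Ioc 0 τ, neumannSqKernel L r x y) ∂μ :=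
    (measurable_lintegral_Ioc_kernel hκ τ).lintegral_prod_right'
  have hrhs : ∫ x, ∫ y, timeIntegratedSqKernel L τ x y ∂μ ∂μ =
      (∫⁻ x, ∫⁻ y, (∫⁻ r in Set.Ioc 0 τ, neumannSqKernel L r x y) ∂μ ∂μ).toReal := by
    rw [← integral_toReal hqm.aemeasurable]
    · refine integral_congr_ae ?_
      filter_upwards [ae_mem_Icc_restrict_Ioc L] with x hx
      exact integral_timeIntegratedSqKernel_eq hL τ hx
    · filter_upwards [ae_mem_Icc_restrict_Ioc L] with x hx
      exact (lintegral_timeIntegratedSqKernel_le hL τ hx).trans_lt hGfin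
  rw [hlhs, hrhs]
  congr 1
  calc ∫⁻ s in Set.Ioc 0 τ, ∫⁻ y, ∫⁻ x, neumannSqKernel L s x y ∂μ ∂μ
      = ∫⁻ s in Set.Ioc 0 τ, ∫⁻ x, ∫⁻ y, neumannSqKernel L s x y ∂μ ∂μ :=
        lintegral_congr fun s => (lintegral_lintegral_swap (hxm s).aemeasurable).symm
    _ = ∫⁻ x, (∫⁻ s in Set.Ioc 0 τ, ∫⁻ y, neumannSqKernel L s x y ∂μ) ∂μ := by
        refine lintegral_lintegral_swap (Measurable.aemeasurable ?_)
        exact Measurable.lintegral_prod_right'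
          (f := fun z : (ℝ × ℝ) × ℝ => neumannSqKernel L z.1.1 z.1.2 z.2)
          (hκ.comp (by fun_prop : Measurable fun z : (ℝ × ℝ) × ℝ => (z.1.1, z.1.2, z.2)))
    _ = _ := lintegral_congr fun x => (lintegral_timeIntegratedSqKernel_swap L τ x).symm

end LowerBound

theorem heatSqOp_iterate_lower_bound
    (L : ℝ) (hL : 0 < L) (k : ℕ) (hk : 1 ≤ k) (t : ℝ) (ht : 0 < t) :
    L * (neumannPhi L (t / k) / L) ^ k
      ≤ ∫ x in (0 : ℝ)..L, ((heatSqOp L)^[k] (fun _ _ => (1 : ℝ))) t x := by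
  have hk0 : (0 : ℝ) < k := by exact_mod_cast hk
  set τ := t / k
  have hτ : 0 < τ := div_pos ht hk0
  have hkτ : k * τ ≤ t := (mul_div_cancel₀ t hk0.ne').le
  have hκ := measurable_neumannSqKernel L
  obtain ⟨m, hm, hmle⟩ := exists_pos_le_integral_timeIntegratedSqKernel hL hτ
  set μ := volume.restrict (Set.Ioc 0 L) with hμ
  set G := ∫⁻ s in Set.Ioc 0 t, neumannSqBound L t s
  have hVm : Measurable fun x => (volterraOp (neumannSqKernel L) μ)^[k] 1 t x :=
    (measurable_iterate_volterraOp hκ k).comp measurable_prodMk_left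
  have hVle : ∀ᵐ x ∂μ, (volterraOp (neumannSqKernel L) μ)^[k] 1 t x ≤ G ^ k := by
    filter_upwards [ae_mem_Icc_restrict_Ioc L] with x hx
    exact iterate_volterraOp_neumannSqKernel_le hL k t hx
  have hGk : G ^ k < ⊤ := ENNReal.pow_lt_top (lintegral_neumannSqBound_lt_top L t)
  have hVfin : ∫⁻ x, (volterraOp (neumannSqKernel L) μ)^[k] 1 t x ∂μ < ⊤ := by
    refine (lintegral_mono_ae hVle).trans_lt ?_
    rw [lintegral_const]
    exact ENNReal.mul_lt_top hGk (measure_lt_top _ _)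
  have hrhs : ∫ x in (0 : ℝ)..L, ((heatSqOp L)^[k] (fun _ _ => (1 : ℝ))) t x =
      (∫⁻ x, (volterraOp (neumannSqKernel L) μ)^[k] 1 t x ∂μ).toReal := by
    rw [intervalIntegral.integral_of_le hL.le, ← hμ,
      ← integral_toReal hVm.aemeasurable (hVle.mono fun x hx => hx.trans_lt hGk)]
    refine integral_congr_ae ?_
    filter_upwards [ae_mem_Icc_restrict_Ioc L] with x hx
    exact iterate_heatSqOp_eq_toReal hL k ht.le hx
  rw [hrhs]
  refine (ENNReal.ofReal_le_iff_le_toReal hVfin.ne).1 ?_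
  have hvol : μ.real Set.univ = L := by
    rw [hμ, measureReal_restrict_apply_univ, Real.volume_real_Ioc_of_le hL.le, sub_zero]
  have hdeg : ∀ᵐ x ∂μ, m ≤ ∫ y, timeIntegratedSqKernel L τ x y ∂μ ∧
      ∫ y, timeIntegratedSqKernel L τ x y ∂μ ≤
        (∫⁻ s in Set.Ioc 0 τ, neumannSqBound L τ s).toReal := by
    filter_upwards [ae_mem_Icc_restrict_Ioc L] with x hx
    refine ⟨hmle x hx, ?_⟩
    rw [integral_timeIntegratedSqKernel_eq hL τ hx]
    exact ENNReal.toReal_mono (lintegral_neumannSqBound_lt_top L τ).ne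
      (lintegral_timeIntegratedSqKernel_le hL τ hx)
  have hmass := lintegral_iterate_ge_of_symmetric (μ := μ)
    (q := timeIntegratedSqKernel L τ) (fun _ _ => ENNReal.toReal_nonneg)
    (measurable_lintegral_Ioc_kernel hκ τ).ennreal_toReal
    (fun x y => by simp only [timeIntegratedSqKernel, neumannSqKernel_symm L _ x y]) hm hdeg
    (hvol ▸ hL) (k - 1)
  rw [Nat.sub_add_cancel hk, hvol, ← neumannPhi_eq_integral_timeIntegratedSqKernel hL hτ]
    at hmass
  refine hmass.trans (lintegral_mono fun x => le_trans ?_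
    (iterate_timeIntegratedOp_le_iterate_volterraOp hκ hτ.le k hkτ x))
  have hmono : ∀ j x, (fun (f : ℝ → ENNReal) x =>
      ∫⁻ y, ENNReal.ofReal (timeIntegratedSqKernel L τ x y) * f y ∂μ)^[j] 1 x ≤
        (timeIntegratedOp (neumannSqKernel L) μ τ)^[j] 1 x := by
    intro j
    induction j with
    | zero => exact fun _ => le_rfl
    | succ j ih =>
      intro x
      rw [iterate_succ_apply', iterate_succ_apply']
      exact lintegral_mono fun y => mul_le_mul' ENNReal.ofReal_toReal_le (ih y)
  exact hmono k x
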